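/- The triple (X_n, Y_n, Z_n) of the numbers of ascents, descents and plateaux of a uniformly random Stirling permutation of length 2n is jointly asymptotically normal with asymptotic covariance matrix Σ = (1/18)·[[2,-1,-1],[-1,2,-1],[-1,-1,2]]: for all real numbers α, β, γ, the random variables n^{-1/2}·(α(X_n - 2n/3) + β(Y_n - 2n/3) + γ(Z_n - 2n/3)) converge in distribution, as n → ∞, to the Gaussian distribution N(0, σ²) with variance σ² = (α,β,γ)Σ(α,β,γ)^T = (2α² + 2β² + 2γ² - 2αβ - 2αγ - 2βγ)/18. -/

import Mathlib

/-- A Stirling permutation of length `2*n`. -/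
def IsStirlingPerm (n : ℕ) (l : List ℕ) : Prop :=
  l.length = 2 * n ∧
  (∀ i : ℕ, 1 ≤ i → i ≤ n → l.count i = 2) ∧
  ∀ p q r : Fin l.length, p < q → q < r → l.get p = l.get r → l.get p < l.get q

/-- The extended sequence `a_0 a_1 … a_{2n} a_{2n+1}` with the convention
`a_0 = a_{2n+1} = 0`: `ext l i = a_i`. -/
def ext (l : List ℕ) (i : ℕ) : ℕ := if i = 0 then 0 else l.getD (i - 1) 0

/-- The number of ascents of `l`: indices `i ∈ {0,…,2n}` with `a_i < a_{i+1}`. -/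
def ascents (l : List ℕ) : ℕ :=
  ((Finset.range (l.length + 1)).filter (fun i => ext l i < ext l (i + 1))).card

/-- The number of descents of `l`: indices `i ∈ {0,…,2n}` with `a_i > a_{i+1}`. -/
def descents (l : List ℕ) : ℕ :=
  ((Finset.range (l.length + 1)).filter (fun i => ext l i > ext l (i + 1))).card

/-- The number of plateaux of `l`: indices `i ∈ {0,…,2n}` with `a_i = a_{i+1}`. -/
def plateaux (l : List ℕ) : ℕ :=
  ((Finset.range (l.length + 1)).filter (fun i => ext l i = ext l (i + 1))).card

open MeasureTheory ProbabilityTheory ENNReal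

/-- We endow `List ℕ` (a countable type) with the discrete σ-algebra. -/
instance : MeasurableSpace (List ℕ) := ⊤

/-- The uniform probability measure on the (finite) set of Stirling permutations of
length `2n`. -/
noncomputable def uniformStirling (n : ℕ) : Measure (List ℕ) :=
  (({l : List ℕ | IsStirlingPerm n l}.ncard : ℝ≥0∞))⁻¹
    • (Measure.count.restrict {l : List ℕ | IsStirlingPerm n l})

open Finset
open scoped BigOperators

theorem IsStirlingPerm.sublist_lt {n : ℕ} {l : List ℕ} (h : IsStirlingPerm n l) {a b : ℕ}
    (hs : [a, b, a].Sublist l) : a < b := by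
  obtain ⟨f, hf⟩ := List.sublist_iff_exists_fin_orderEmbedding_get_eq.1 hs
  have h0 := hf ⟨0, by simp⟩
  have h1 := hf ⟨1, by simp⟩
  have h2 := hf ⟨2, by simp⟩
  simp only [List.get_eq_getElem, List.getElem_cons_zero, List.getElem_cons_succ] at h0 h1 h2
  have := h.2.2 (f ⟨0, by simp⟩) (f ⟨1, by simp⟩) (f ⟨2, by simp⟩) (f.strictMono (by simp))
    (f.strictMono (by simp)) (by simp only [List.get_eq_getElem]; omega)
  simp only [List.get_eq_getElem] at this
  omega

theorem sublist_triple_of_lt {l : List ℕ} {p q r : Fin l.length} (hpq : p < q) (hqr : q < r) :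
    [l.get p, l.get q, l.get r].Sublist l := by
  refine List.sublist_iff_exists_fin_orderEmbedding_get_eq.2
    ⟨OrderEmbedding.ofStrictMono ![p, q, r] ?_, ?_⟩
  · intro i j hij
    fin_cases i <;> fin_cases j <;> simp_all [hpq.trans hqr]
  · intro i
    fin_cases i <;> rfl

theorem isStirlingPerm_iff {n : ℕ} {l : List ℕ} :
    IsStirlingPerm n l ↔ l.length = 2 * n ∧ (∀ i : ℕ, 1 ≤ i → i ≤ n → l.count i = 2) ∧
      ∀ a b, [a, b, a].Sublist l → a < b := by
  refine ⟨fun h => ⟨h.1, h.2.1, fun a b => h.sublist_lt⟩, fun h => ⟨h.1, h.2.1, ?_⟩⟩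
  intro p q r hpq hqr hpr
  refine h.2.2 _ _ ?_
  have := sublist_triple_of_lt hpq hqr
  rwa [← hpr] at this

theorem sum_count_le_length (l : List ℕ) (s : Finset ℕ) : ∑ i ∈ s, l.count i ≤ l.length := by
  induction l with
  | nil => simp
  | cons x l ih =>
    simp only [List.count_cons, List.length_cons, sum_add_distrib]
    gcongr
    simp only [beq_iff_eq, sum_ite_eq]
    split <;> simp

theorem IsStirlingPerm.mem_Icc {n : ℕ} {l : List ℕ} (h : IsStirlingPerm n l) {x : ℕ}
    (hx : x ∈ l) : x ∈ Icc 1 n := by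
  by_contra hn
  have h1 := sum_count_le_length l (insert x (Icc 1 n))
  rw [sum_insert hn, sum_congr rfl (g := fun _ => 2), h.1] at h1
  · have := List.count_pos_iff.2 hx
    simp at h1
    omega
  · intro i hi
    rw [Finset.mem_Icc] at hi
    exact h.2.1 i hi.1 hi.2

/-- Insert two adjacent copies of `m` into `l` at position `i`. -/
def insertPair (m i : ℕ) (l : List ℕ) : List ℕ := l.take i ++ m :: m :: l.drop i

/-- The finite set of Stirling permutations of length `2 * n`, generated by successive insertions
of pairs of adjacent maxima. -/
def stirlingPerms : ℕ → Finset (List ℕ)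
  | 0 => {[]}
  | n + 1 => (stirlingPerms n ×ˢ range (2 * n + 1)).image fun p => insertPair (n + 1) p.2 p.1

theorem isStirlingPerm_append_pair_iff {n : ℕ} {u v : List ℕ} (h : n + 1 ∉ u ++ v) :
    IsStirlingPerm (n + 1) (u ++ (n + 1) :: (n + 1) :: v) ↔ IsStirlingPerm n (u ++ v) := by
  have hu : n + 1 ∉ u := fun hu => h (by simp [hu])
  have hv : n + 1 ∉ v := fun hv => h (by simp [hv])
  have hsub : (u ++ v).Sublist (u ++ (n + 1) :: (n + 1) :: v) := by simp
  constructor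
  · intro H
    rw [isStirlingPerm_iff] at H ⊢
    refine ⟨?_, ?_, fun a b hab => H.2.2 a b (hab.trans hsub)⟩
    · have := H.1
      simp at this ⊢
      omega
    · intro i hi hin
      have := H.2.1 i hi (by omega)
      simpa [List.count_append, List.count_cons_of_ne (by omega : n + 1 ≠ i)] using this
  · intro H
    have Hmem := fun x => @IsStirlingPerm.mem_Icc _ _ H x
    rw [isStirlingPerm_iff] at H ⊢
    refine ⟨?_, ?_, ?_⟩
    · have := H.1
      simp at this ⊢
      omega
    · intro i hi hin
      by_cases hi' : i = n + 1
      · subst hi'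
        simp [List.count_append, List.count_eq_zero_of_not_mem hu,
          List.count_eq_zero_of_not_mem hv]
      · have := H.2.1 i hi (by omega)
        simpa [List.count_cons, List.count_append, Ne.symm hi'] using this
    · intro a b hab
      have hfilter : (u ++ (n + 1) :: (n + 1) :: v).filter (· ≠ n + 1) = u ++ v := by
        rw [List.filter_append]
        simp only [ne_eq, not_true_eq_false, decide_false, Bool.false_eq_true, not_false_eq_true,
          List.filter_cons_of_neg]
        rw [← List.filter_append, List.filter_eq_self]
        intro x hx
        simpa using ne_of_mem_of_not_mem hx h
      by_cases ha : a = n + 1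
      · subst ha
        exfalso
        have h1 : [n + 1, b, n + 1].Sublist ((n + 1) :: (n + 1) :: v) := by
          obtain ⟨l₁, l₂, he, h₁, h₂⟩ := List.sublist_append_iff.1 hab
          cases l₁ with
          | nil => simpa [he] using h₂
          | cons x l₁ =>
            simp only [List.cons_append, List.cons.injEq] at he
            exact absurd (h₁.subset (by simp [← he.1])) hu
        rw [List.cons_sublist_cons] at h1
        rcases List.sublist_cons_iff.1 h1 with h2 | ⟨r, hr, h2⟩
        · exact hv (h2.subset (by simp))
        · obtain ⟨-, rfl⟩ := List.cons.inj hr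
          exact hv (h2.subset (by simp))
      · by_cases hb : b = n + 1
        · have : a ∈ u ++ v := by
            have := hab.subset (show a ∈ [a, b, a] by simp)
            simpa [ha] using this
          have := Finset.mem_Icc.1 (Hmem a this)
          omega
        · refine H.2.2 a b ?_
          have := hab.filter (· ≠ n + 1)
          rw [hfilter] at this
          simpa [ha, hb] using this

theorem IsStirlingPerm.exists_append_pair {n : ℕ} {l : List ℕ} (h : IsStirlingPerm (n + 1) l) :
    ∃ u v, l = u ++ (n + 1) :: (n + 1) :: v ∧ n + 1 ∉ u ++ v := by
  have hc := h.2.1 (n + 1) (by omega) le_rfl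
  obtain ⟨u, w, rfl, hu⟩ := List.eq_append_cons_of_mem
    (List.count_pos_iff.1 (by omega : 0 < l.count (n + 1)))
  simp only [List.count_append, List.count_eq_zero_of_not_mem hu, List.count_cons_self] at hc
  obtain ⟨u', v, rfl, hu'⟩ := List.eq_append_cons_of_mem
    (List.count_pos_iff.1 (by omega : 0 < w.count (n + 1)))
  simp only [List.count_append, List.count_eq_zero_of_not_mem hu', List.count_cons_self] at hc
  have hv : n + 1 ∉ v := List.count_eq_zero.1 (by omega)
  cases u' with
  | nil => exact ⟨u, v, rfl, by simp [hu, hv]⟩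
  | cons b u' =>
    exfalso
    have h1 : n + 1 < b := h.sublist_lt <|
      (show [n + 1, b, n + 1].Sublist ((n + 1) :: (b :: u' ++ (n + 1) :: v)) by simp).trans
        (List.sublist_append_right _ _)
    have := Finset.mem_Icc.1 (h.mem_Icc (x := b) (by simp))
    omega

theorem mem_stirlingPerms {n : ℕ} {l : List ℕ} : l ∈ stirlingPerms n ↔ IsStirlingPerm n l := by
  induction n generalizing l with
  | zero =>
    simp only [stirlingPerms, mem_singleton, IsStirlingPerm]
    constructor
    · rintro rfl
      exact ⟨rfl, fun i hi hi' => by omega, fun p => p.elim0⟩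
    · exact fun h => List.length_eq_zero_iff.1 (by simpa using h.1)
  | succ n ih =>
    simp only [stirlingPerms, mem_image, mem_product, mem_range, Prod.exists, ih]
    constructor
    · rintro ⟨l, i, ⟨hl, -⟩, rfl⟩
      have : n + 1 ∉ l.take i ++ l.drop i := by
        rw [List.take_append_drop]
        intro hm
        have := Finset.mem_Icc.1 (hl.mem_Icc hm)
        omega
      rwa [insertPair, isStirlingPerm_append_pair_iff this, List.take_append_drop]
    · intro h
      obtain ⟨u, v, rfl, huv⟩ := h.exists_append_pair
      rw [isStirlingPerm_append_pair_iff huv] at h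
      refine ⟨u ++ v, u.length, ⟨h, ?_⟩, by simp [insertPair]⟩
      have := h.1
      simp at this
      omega

theorem not_mem_of_mem_stirlingPerms {n : ℕ} {l : List ℕ} (h : l ∈ stirlingPerms n) :
    n + 1 ∉ l := fun hm => by
  have := Finset.mem_Icc.1 ((mem_stirlingPerms.1 h).mem_Icc hm)
  omega

theorem insertPair_injOn (n : ℕ) :
    Set.InjOn (fun p : List ℕ × ℕ => insertPair (n + 1) p.2 p.1)
      (stirlingPerms n ×ˢ range (2 * n + 1) : Finset (List ℕ × ℕ)) := by
  have hfilter {l : List ℕ} {i : ℕ} (hl : n + 1 ∉ l) :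
      (insertPair (n + 1) i l).filter (· ≠ n + 1) = l := by
    rw [insertPair, List.filter_append]
    simp only [ne_eq, not_true_eq_false, decide_false, Bool.false_eq_true, not_false_eq_true,
      List.filter_cons_of_neg]
    rw [← List.filter_append, List.take_append_drop, List.filter_eq_self]
    intro x hx
    simpa using ne_of_mem_of_not_mem hx hl
  have hidx {l : List ℕ} {i : ℕ} (hl : n + 1 ∉ l) (hi : i ≤ l.length) :
      (insertPair (n + 1) i l).idxOf (n + 1) = i := by
    rw [insertPair, List.idxOf_append_of_notMem (fun h => hl (List.mem_of_mem_take h))]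
    simp [hi]
  rintro ⟨l, i⟩ h ⟨l', i'⟩ h' he
  simp only [coe_product, Set.mem_prod, mem_coe, Finset.mem_range] at h h'
  have hl := not_mem_of_mem_stirlingPerms h.1
  have hl' := not_mem_of_mem_stirlingPerms h'.1
  simp only at he
  have e1 : l = l' := by rw [← hfilter (i := i) hl, he, hfilter hl']
  subst e1
  have hlen := (mem_stirlingPerms.1 h.1).1
  rw [Prod.mk.injEq]
  refine ⟨rfl, ?_⟩
  rw [← hidx hl (by omega : i ≤ l.length), he, hidx hl (by omega)]

theorem stirlingPerms_nonempty (n : ℕ) : (stirlingPerms n).Nonempty := by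
  induction n with
  | zero => simp [stirlingPerms]
  | succ n ih => simpa [stirlingPerms] using ih

theorem expect_stirlingPerms_succ {M : Type*} [AddCommMonoid M] [Module ℚ≥0 M] (n : ℕ)
    (F : List ℕ → M) :
    𝔼 l ∈ stirlingPerms (n + 1), F l =
      𝔼 l ∈ stirlingPerms n, 𝔼 i ∈ range (2 * n + 1), F (insertPair (n + 1) i l) := by
  rw [← Finset.expect_product', stirlingPerms, Finset.expect, Finset.expect,
    sum_image (insertPair_injOn n), card_image_of_injOn (insertPair_injOn n)]

/-- The weight of a pair `x, y` of consecutive entries: `a` for an ascent, `b` for a descent and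
`c` for a plateau. -/
def gapWeight (a b c : ℝ) (x y : ℕ) : ℝ := if x < y then a else if y < x then b else c

/-- The sum of the weights of all pairs of consecutive entries of the extended sequence. -/
def totalWeight (a b c : ℝ) (l : List ℕ) : ℝ :=
  ∑ i ∈ range (l.length + 1), gapWeight a b c (ext l i) (ext l (i + 1))

theorem totalWeight_eq (a b c : ℝ) (l : List ℕ) :
    totalWeight a b c l = a * ascents l + b * descents l + c * plateaux l := by
  simp only [ascents, descents, plateaux, card_filter, Nat.cast_sum, mul_sum, totalWeight,
    ← sum_add_distrib]
  refine sum_congr rfl fun i _ => ?_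
  rcases lt_trichotomy (ext l i) (ext l (i + 1)) with h | h | h
  · simp [gapWeight, h, h.ne, h.not_gt]
  · simp [gapWeight, h]
  · simp [gapWeight, h, h.ne', h.not_gt]

theorem ext_insertPair {m i : ℕ} {l : List ℕ} (hi : i ≤ l.length) (k : ℕ) :
    ext (insertPair m i l) k =
      if k ≤ i then ext l k else if k ≤ i + 2 then m else ext l (k - 2) := by
  have hlen : (l.take i).length = i := by simp [hi]
  unfold _root_.ext insertPair
  rcases Nat.eq_zero_or_pos k with rfl | hk
  · simp
  rw [if_neg hk.ne', if_neg hk.ne']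
  split_ifs with h1 h2 h3
  · rw [List.getD_append _ _ _ _ (by omega)]
    simp [List.getD_eq_getElem?_getD, (by omega : k - 1 < i)]
  · rw [List.getD_append_right _ _ _ _ (by omega), hlen]
    obtain h | h : k - 1 - i = 0 ∨ k - 1 - i = 1 := by omega
    all_goals simp [h]
  · omega
  · rw [List.getD_append_right _ _ _ _ (by omega), hlen]
    obtain ⟨j, rfl⟩ : ∃ j, k = i + 3 + j := ⟨k - i - 3, by omega⟩
    have : i + 3 + j - 1 - i = j + 1 + 1 := by omega
    rw [this, List.getD_cons_succ, List.getD_cons_succ]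
    simp only [List.getD_eq_getElem?_getD, List.getElem?_drop]
    congr 2
    omega

theorem totalWeight_insertPair (a b c : ℝ) {m i : ℕ} {l : List ℕ} (hi : i ≤ l.length)
    (hm : 0 < m) (hl : ∀ x ∈ l, x < m) :
    totalWeight a b c (insertPair m i l) =
      totalWeight a b c l + (a + b + c) - gapWeight a b c (ext l i) (ext l (i + 1)) := by
  have hext : ∀ k, ext l k < m := by
    intro k
    unfold _root_.ext
    split_ifs
    · exact hm
    · rcases lt_or_ge (k - 1) l.length with h | h
      · rw [List.getD_eq_getElem _ _ h]
        exact hl _ (List.getElem_mem h)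
      · rwa [List.getD_eq_default _ _ h]
  obtain ⟨j, hj⟩ : ∃ j, l.length = i + j := ⟨l.length - i, by omega⟩
  have hlen : (insertPair m i l).length + 1 = i + (3 + j) := by
    simp [insertPair]
    omega
  have hlen' : l.length + 1 = i + (1 + j) := by omega
  unfold totalWeight
  rw [hlen, hlen', sum_range_add, sum_range_add _ 3, sum_range_add _ i (1 + j), sum_range_add _ 1]
  have h1 : ∀ k ∈ range i, gapWeight a b c (ext (insertPair m i l) k)
      (ext (insertPair m i l) (k + 1)) = gapWeight a b c (ext l k) (ext l (k + 1)) := by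
    intro k hk
    rw [Finset.mem_range] at hk
    rw [ext_insertPair hi, ext_insertPair hi, if_pos (by omega), if_pos (by omega)]
  have h2 : ∀ k ∈ range j, gapWeight a b c (ext (insertPair m i l) (i + (3 + k)))
      (ext (insertPair m i l) (i + (3 + k) + 1)) =
      gapWeight a b c (ext l (i + (1 + k))) (ext l (i + (1 + k) + 1)) := by
    intro k hk
    rw [ext_insertPair hi, ext_insertPair hi, if_neg (by omega), if_neg (by omega),
      if_neg (by omega), if_neg (by omega)]
    congr 2 <;> omega
  rw [sum_congr rfl h1, sum_congr rfl h2]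
  have e0 := hext i
  have e1 := hext (i + 1)
  simp [sum_range_succ, ext_insertPair hi, gapWeight, e0, e1, e1.not_gt]
  ring

theorem norm_exp_neg_mul_I_sub_taylor_le {y : ℝ} (hy : |y| ≤ 1) :
    ‖Complex.exp (-(y * Complex.I)) - (1 - y * Complex.I - y ^ 2 / 2)‖ ≤ |y| ^ 3 * (2 / 9) := by
  have hn : ‖(-(y * Complex.I) : ℂ)‖ = |y| := by simp
  have h := Complex.exp_bound (x := -(y * Complex.I)) (by rw [hn]; exact hy) (n := 3) (by norm_num)
  rw [hn] at h
  have e : ∑ m ∈ range 3, (-(y * Complex.I) : ℂ) ^ m / m.factorial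
      = 1 - y * Complex.I - y ^ 2 / 2 := by
    simp only [sum_range_succ, sum_range_zero, neg_sq, mul_pow, Complex.I_sq]
    norm_num
    ring
  rw [e] at h
  refine h.trans_eq ?_
  norm_num [Nat.factorial]

/-- Comparison of an averaged character with a Gaussian factor matching its first two moments. -/
theorem norm_expect_exp_sub_le {ι : Type*} {s : Finset ι} (hs : s.Nonempty) {y : ι → ℝ}
    {ε v : ℝ} (hε : ε ≤ 1) (hy : ∀ i ∈ s, |y i| ≤ ε) (hv0 : 0 ≤ v) (hv : v ≤ ε ^ 2) :
    ‖𝔼 i ∈ s, Complex.exp (-(y i * Complex.I)) -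
        Complex.exp (-((𝔼 i ∈ s, y i : ℝ) * Complex.I)) * Real.exp (-(v / 2))‖ ≤
      ε ^ 3 + (𝔼 i ∈ s, y i) ^ 2 + |𝔼 i ∈ s, y i ^ 2 - v| / 2 := by
  set m := 𝔼 i ∈ s, y i with hm
  set V := 𝔼 i ∈ s, y i ^ 2 with hV
  have hε0 : 0 ≤ ε := by
    obtain ⟨i, hi⟩ := hs
    exact (abs_nonneg _).trans (hy i hi)
  have hmε : |m| ≤ ε := (abs_expect_le s y).trans (expect_le hs hy)
  have h1 : ‖𝔼 i ∈ s, Complex.exp (-(y i * Complex.I)) - (1 - m * Complex.I - V / 2)‖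
      ≤ ε ^ 3 * (2 / 9) := by
    have e : (1 - m * Complex.I - V / 2 : ℂ) =
        𝔼 i ∈ s, (1 - y i * Complex.I - (y i : ℂ) ^ 2 / 2) := by
      rw [expect_sub_distrib, expect_sub_distrib, ← expect_mul, ← expect_div, expect_const hs, hm,
        hV]
      congr 3
      · exact RCLike.ofReal_expect (K := ℂ) s y
      · rw [← Complex.coe_algebraMap]
        simp
    rw [e, ← expect_sub_distrib]
    refine (RCLike.norm_expect_le (K := ℂ)).trans (expect_le hs fun i hi => ?_)
    refine (norm_exp_neg_mul_I_sub_taylor_le ((hy i hi).trans hε)).trans ?_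
    gcongr
    exact hy i hi
  have hn : ‖(-(m * Complex.I) : ℂ)‖ = |m| := by simp
  have h2 : ‖Complex.exp (-(m * Complex.I)) - 1 - -(m * Complex.I)‖ ≤ m ^ 2 := by
    have := Complex.norm_exp_sub_one_sub_id_le (x := -(m * Complex.I)) (by rw [hn]; linarith)
    rwa [hn, sq_abs] at this
  have h3 : |Real.exp (-(v / 2)) - 1 - -(v / 2)| ≤ ε ^ 3 / 4 := by
    have hv1 : v ≤ 1 := hv.trans (pow_le_one₀ hε0 hε)
    refine (Real.abs_exp_sub_one_sub_id_le (by rw [abs_neg, abs_of_nonneg] <;> linarith)).trans ?_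
    have : v * v ≤ ε ^ 2 * ε := by
      gcongr
      nlinarith
    nlinarith
  have hu : ‖Complex.exp (-(m * Complex.I))‖ = 1 := by
    simpa using Complex.norm_exp_ofReal_mul_I (-m)
  have h4 : ‖Complex.exp (-(m * Complex.I)) - 1‖ ≤ ε := by
    have := Real.norm_exp_I_mul_ofReal_sub_one_le (x := -m)
    rw [Real.norm_eq_abs, abs_neg] at this
    refine le_trans (le_of_eq ?_) (this.trans hmε)
    congr 3
    push_cast
    ring
  set E := Complex.exp (-(m * Complex.I))
  set A := 𝔼 i ∈ s, Complex.exp (-(y i * Complex.I))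
  have key : A - E * Real.exp (-(v / 2)) = (A - (1 - m * Complex.I - V / 2))
      - (E - 1 - -(m * Complex.I)) - ((V - v : ℝ) / 2 : ℂ) + (v / 2 : ℝ) * (E - 1)
      - E * ((Real.exp (-(v / 2)) - 1 - -(v / 2) : ℝ) : ℂ) := by
    push_cast
    ring
  rw [key]
  have h5 : ‖((V - v : ℝ) / 2 : ℂ)‖ = |V - v| / 2 := by
    rw [norm_div, Complex.norm_real, Real.norm_eq_abs]
    simp
  have h6 : ‖((v / 2 : ℝ) * (E - 1) : ℂ)‖ ≤ ε ^ 3 / 2 := by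
    rw [norm_mul, Complex.norm_real, Real.norm_of_nonneg (by positivity)]
    calc v / 2 * ‖E - 1‖ ≤ ε ^ 2 / 2 * ε := by gcongr
      _ = ε ^ 3 / 2 := by ring
  have h7 : ‖E * ((Real.exp (-(v / 2)) - 1 - -(v / 2) : ℝ) : ℂ)‖ ≤ ε ^ 3 / 4 := by
    rw [norm_mul, hu, one_mul, Complex.norm_real]
    exact h3
  refine (norm_sub_le _ _).trans ?_
  refine (add_le_add_left (norm_add_le _ _) _).trans ?_
  refine (add_le_add_left (add_le_add_left (norm_sub_le _ _) _) _).trans ?_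
  refine (add_le_add_left (add_le_add_left (add_le_add_left (norm_sub_le _ _) _) _) _).trans ?_
  have : 0 ≤ ε ^ 3 := by positivity
  linarith

theorem abs_gapWeight_le {a b c M : ℝ} (ha : |a| ≤ M) (hb : |b| ≤ M) (hc : |c| ≤ M) (x y : ℕ) :
    |gapWeight a b c x y| ≤ M := by
  unfold gapWeight
  split_ifs <;> assumption

theorem gapWeight_sq (a b c : ℝ) (x y : ℕ) :
    gapWeight a b c x y ^ 2 = gapWeight (a ^ 2) (b ^ 2) (c ^ 2) x y := by
  unfold gapWeight
  split_ifs <;> rfl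

theorem expect_gapWeight {n : ℕ} {l : List ℕ} (hl : l ∈ stirlingPerms n) (a b c : ℝ) :
    𝔼 i ∈ range (2 * n + 1), gapWeight a b c (_root_.ext l i) (_root_.ext l (i + 1)) =
      totalWeight a b c l / (2 * n + 1) := by
  rw [expect_eq_sum_div_card, totalWeight, (mem_stirlingPerms.1 hl).1]
  simp

theorem totalWeight_insertPair_of_mem {a b c : ℝ} (h0 : a + b + c = 0) {n i : ℕ} {l : List ℕ}
    (hl : l ∈ stirlingPerms n) (hi : i ∈ range (2 * n + 1)) :
    totalWeight a b c (insertPair (n + 1) i l) =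
      totalWeight a b c l - gapWeight a b c (_root_.ext l i) (_root_.ext l (i + 1)) := by
  rw [mem_stirlingPerms] at hl
  rw [totalWeight_insertPair, h0, add_zero]
  · have := hl.1
    rw [Finset.mem_range] at hi
    omega
  · omega
  · intro x hx
    have := Finset.mem_Icc.1 (hl.mem_Icc hx)
    omega

theorem expect_totalWeight_sq_le {a b c M : ℝ} (h0 : a + b + c = 0) (ha : |a| ≤ M) (hb : |b| ≤ M)
    (hc : |c| ≤ M) (n : ℕ) :
    𝔼 l ∈ stirlingPerms n, totalWeight a b c l ^ 2 ≤ (2 * n + 1) * M ^ 2 := by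
  have hM : 0 ≤ M := (abs_nonneg a).trans ha
  induction n with
  | zero =>
    simpa [stirlingPerms, totalWeight, gapWeight, _root_.ext] using
      (sq_le_sq₀ (abs_nonneg c) hM).2 hc
  | succ n ih =>
    rw [expect_stirlingPerms_succ]
    have : ∀ l ∈ stirlingPerms n, 𝔼 i ∈ range (2 * n + 1),
        totalWeight a b c (insertPair (n + 1) i l) ^ 2 ≤ totalWeight a b c l ^ 2 + M ^ 2 := by
      intro l hl
      have hle : ∀ i ∈ range (2 * n + 1), totalWeight a b c (insertPair (n + 1) i l) ^ 2 ≤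
          totalWeight a b c l ^ 2 + M ^ 2 - 2 * totalWeight a b c l *
            gapWeight a b c (_root_.ext l i) (_root_.ext l (i + 1)) := by
        intro i hi
        rw [totalWeight_insertPair_of_mem h0 hl hi]
        have := sq_le_sq' (abs_le.1 (abs_gapWeight_le ha hb hc (_root_.ext l i)
          (_root_.ext l (i + 1)))).1 (abs_le.1 (abs_gapWeight_le ha hb hc _ _)).2
        linarith
      refine (expect_le_expect hle).trans ?_
      rw [expect_sub_distrib, expect_const (by simp), ← mul_expect, expect_gapWeight hl]
      have : 0 ≤ 2 * totalWeight a b c l * (totalWeight a b c l / (2 * n + 1)) := by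
        rw [mul_assoc, mul_div_assoc', ← sq]
        positivity
      linarith
    refine (expect_le_expect this).trans ?_
    rw [expect_add_distrib, expect_const (stirlingPerms_nonempty n)]
    push_cast
    nlinarith [sq_nonneg M]

theorem expect_abs_totalWeight_le {a b c M : ℝ} (h0 : a + b + c = 0) (ha : |a| ≤ M) (hb : |b| ≤ M)
    (hc : |c| ≤ M) (n : ℕ) :
    𝔼 l ∈ stirlingPerms n, |totalWeight a b c l| ≤ √(2 * n + 1) * M := by
  have hM : 0 ≤ M := (abs_nonneg a).trans ha
  refine abs_le_of_sq_le_sq' ?_ (by positivity) |>.2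
  rw [mul_pow, Real.sq_sqrt (by positivity)]
  refine le_trans ?_ (expect_totalWeight_sq_le h0 ha hb hc n)
  have := expect_mul_sq_le_sq_mul_sq (stirlingPerms n) (fun l => |totalWeight a b c l|) fun _ => 1
  simpa [expect_const (stirlingPerms_nonempty n)] using this

/-- The characteristic function of the total weight of a uniform Stirling permutation. -/
noncomputable def weightCharFun (a b c : ℝ) (n : ℕ) (t : ℝ) : ℂ :=
  𝔼 l ∈ stirlingPerms n, Complex.exp ((t * totalWeight a b c l : ℝ) * Complex.I)

theorem norm_weightCharFun_succ_sub_le {a b c M : ℝ} (h0 : a + b + c = 0) (ha : |a| ≤ M)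
    (hb : |b| ≤ M) (hc : |c| ≤ M) (n : ℕ) {t : ℝ} (ht : M * |t| ≤ 1) :
    ‖weightCharFun a b c (n + 1) t - weightCharFun a b c n (2 * n / (2 * n + 1) * t) *
        Real.exp (-((a ^ 2 + b ^ 2 + c ^ 2) / 3 * t ^ 2 / 2))‖ ≤
      (M * |t|) ^ 3 + 2 * ((M * |t|) ^ 2 / √(2 * n + 1)) := by
  have hM : 0 ≤ M := (abs_nonneg a).trans ha
  set s := (a ^ 2 + b ^ 2 + c ^ 2) / 3 with hs
  set N : ℝ := 2 * n + 1 with hN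
  have hN1 : 1 ≤ N := by simp [hN]
  have hN0 : 0 < N := by linarith
  have ha2 : a ^ 2 ≤ M ^ 2 := sq_le_sq' (abs_le.1 ha).1 (abs_le.1 ha).2
  have hb2 : b ^ 2 ≤ M ^ 2 := sq_le_sq' (abs_le.1 hb).1 (abs_le.1 hb).2
  have hc2 : c ^ 2 ≤ M ^ 2 := sq_le_sq' (abs_le.1 hc).1 (abs_le.1 hc).2
  have hs0 : 0 ≤ s := by positivity
  have hsM : s ≤ M ^ 2 := by linarith
  have hε2 : (M * |t|) ^ 2 = M ^ 2 * t ^ 2 := by rw [mul_pow, sq_abs]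
  have hpt : ∀ l ∈ stirlingPerms n,
      ‖𝔼 i ∈ range (2 * n + 1), Complex.exp
          ((t * totalWeight a b c (insertPair (n + 1) i l) : ℝ) * Complex.I) -
        Complex.exp ((2 * n / N * t * totalWeight a b c l : ℝ) * Complex.I) *
          Real.exp (-(s * t ^ 2 / 2))‖ ≤
      (M * |t|) ^ 3 + (t ^ 2 / N ^ 2) * totalWeight a b c l ^ 2 +
        t ^ 2 / (2 * N) * |totalWeight (a ^ 2 - s) (b ^ 2 - s) (c ^ 2 - s) l| := by
    intro l hl
    set W := totalWeight a b c l
    set w : ℕ → ℝ := fun i => gapWeight a b c (_root_.ext l i) (_root_.ext l (i + 1)) with hw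
    have hmean : 𝔼 i ∈ range (2 * n + 1), t * w i = t * (W / N) := by
      rw [← mul_expect, expect_gapWeight hl]
    have hvar : 𝔼 i ∈ range (2 * n + 1), (t * w i) ^ 2 - s * t ^ 2 =
        t ^ 2 * (totalWeight (a ^ 2 - s) (b ^ 2 - s) (c ^ 2 - s) l / N) := by
      have e : ∀ i, (t * w i) ^ 2 = t ^ 2 * gapWeight (a ^ 2 - s) (b ^ 2 - s) (c ^ 2 - s)
          (_root_.ext l i) (_root_.ext l (i + 1)) + s * t ^ 2 := by
        intro i
        rw [mul_pow, hw, gapWeight_sq]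
        unfold gapWeight
        split_ifs <;> ring
      simp only [e]
      rw [expect_add_distrib, expect_const (by simp), ← mul_expect, expect_gapWeight hl]
      ring
    have h := norm_expect_exp_sub_le (s := range (2 * n + 1)) (by simp) (y := fun i => t * w i)
      (ε := M * |t|) (v := s * t ^ 2) ht
      (fun i _ => by
        rw [abs_mul, mul_comm]
        gcongr
        exact abs_gapWeight_le ha hb hc _ _)
      (by positivity) (by rw [hε2]; gcongr)
    rw [hmean, hvar] at h
    have e1 : 𝔼 i ∈ range (2 * n + 1), Complex.exp
          ((t * totalWeight a b c (insertPair (n + 1) i l) : ℝ) * Complex.I) =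
        Complex.exp ((t * W : ℝ) * Complex.I) *
          𝔼 i ∈ range (2 * n + 1), Complex.exp (-((t * w i : ℝ) * Complex.I)) := by
      rw [mul_expect]
      refine expect_congr rfl fun i hi => ?_
      rw [totalWeight_insertPair_of_mem h0 hl hi, ← Complex.exp_add]
      congr 1
      push_cast
      ring
    have e2 : Complex.exp ((2 * n / N * t * W : ℝ) * Complex.I) =
        Complex.exp ((t * W : ℝ) * Complex.I) *
          Complex.exp (-((t * (W / N) : ℝ) * Complex.I)) := by
      rw [← Complex.exp_add]
      congr 1
      rw [← neg_mul, ← add_mul, ← Complex.ofReal_neg, ← Complex.ofReal_add]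
      congr 2
      field_simp
      rw [hN]
      ring
    rw [e1, e2, mul_assoc, ← mul_sub, norm_mul, Complex.norm_exp_ofReal_mul_I, one_mul]
    refine h.trans_eq ?_
    rw [abs_mul, abs_div, abs_of_pos hN0, abs_of_nonneg (sq_nonneg t)]
    field_simp
  have hEW := expect_totalWeight_sq_le h0 ha hb hc n
  have habs : ∀ x : ℝ, 0 ≤ x → x ≤ M ^ 2 → |x - s| ≤ M ^ 2 := fun x hx hxM =>
    abs_le.2 ⟨by linarith, by linarith⟩
  have hEB := expect_abs_totalWeight_le (a := a ^ 2 - s) (b := b ^ 2 - s) (c := c ^ 2 - s)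
    (by rw [hs]; ring) (habs _ (sq_nonneg a) ha2) (habs _ (sq_nonneg b) hb2)
    (habs _ (sq_nonneg c) hc2) n
  rw [← hN] at hEW hEB
  rw [weightCharFun, weightCharFun, expect_stirlingPerms_succ, expect_mul, ← expect_sub_distrib]
  refine (RCLike.norm_expect_le (K := ℂ)).trans ((expect_le_expect hpt).trans ?_)
  rw [expect_add_distrib, expect_add_distrib, expect_const (stirlingPerms_nonempty n),
    ← mul_expect, ← mul_expect]
  have hsq : √N * √N = N := Real.mul_self_sqrt hN0.le
  have hsq1 : 1 ≤ √N := Real.one_le_sqrt.2 hN1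
  have b1 : t ^ 2 / N ^ 2 * 𝔼 l ∈ stirlingPerms n, totalWeight a b c l ^ 2 ≤
      (M * |t|) ^ 2 / √N := by
    calc _ ≤ t ^ 2 / N ^ 2 * (N * M ^ 2) := by gcongr
      _ = (M * |t|) ^ 2 / N := by
        rw [hε2]
        field_simp
      _ ≤ (M * |t|) ^ 2 / √N := by
        gcongr
        nlinarith
  have b2 : t ^ 2 / (2 * N) * 𝔼 l ∈ stirlingPerms n,
      |totalWeight (a ^ 2 - s) (b ^ 2 - s) (c ^ 2 - s) l| ≤ (M * |t|) ^ 2 / √N := by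
    calc _ ≤ t ^ 2 / (2 * N) * (√N * M ^ 2) := by gcongr
      _ = (M * |t|) ^ 2 / √N / 2 := by
        rw [hε2]
        nth_rewrite 1 [← hsq]
        field_simp
      _ ≤ (M * |t|) ^ 2 / √N := half_le_self (by positivity)
  linarith

theorem abs_exp_neg_sub_exp_neg_le {x y : ℝ} (hx : 0 ≤ x) (hy : 0 ≤ y) :
    |Real.exp (-x) - Real.exp (-y)| ≤ |x - y| := by
  wlog h : x ≤ y generalizing x y
  · rw [abs_sub_comm, abs_sub_comm x]
    exact this hy hx (le_of_not_ge h)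
  have h1 : Real.exp (-y) ≤ Real.exp (-x) := Real.exp_le_exp.2 (by linarith)
  rw [abs_of_nonneg (by linarith), abs_of_nonpos (by linarith)]
  have h2 : Real.exp (-x) ≤ 1 := Real.exp_le_one_iff.2 (by linarith)
  have h3 : Real.exp (-y) = Real.exp (-x) * Real.exp (-(y - x)) := by
    rw [← Real.exp_add]
    congr 1
    ring
  have h4 := Real.one_sub_le_exp_neg (y - x)
  rw [h3]
  nlinarith [Real.exp_pos (-x)]

theorem norm_weightCharFun_sub_exp_le {a b c M : ℝ} (h0 : a + b + c = 0) (ha : |a| ≤ M)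
    (hb : |b| ≤ M) (hc : |c| ≤ M) (n : ℕ) {t : ℝ} (ht : M * |t| ≤ 1) :
    ‖weightCharFun a b c n t -
        Real.exp (-((a ^ 2 + b ^ 2 + c ^ 2) / 3 * (2 * n + 1) * t ^ 2 / 8))‖ ≤
      3 * (M * |t| + √(2 * n + 1) * (M * |t|) ^ 2 + (2 * n + 1) * (M * |t|) ^ 3) := by
  have hM : 0 ≤ M := (abs_nonneg a).trans ha
  have hs0 : 0 ≤ (a ^ 2 + b ^ 2 + c ^ 2) / 3 := by positivity
  have hsM : (a ^ 2 + b ^ 2 + c ^ 2) / 3 ≤ M ^ 2 := by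
    have ha2 : a ^ 2 ≤ M ^ 2 := sq_le_sq' (abs_le.1 ha).1 (abs_le.1 ha).2
    have hb2 : b ^ 2 ≤ M ^ 2 := sq_le_sq' (abs_le.1 hb).1 (abs_le.1 hb).2
    have hc2 : c ^ 2 ≤ M ^ 2 := sq_le_sq' (abs_le.1 hc).1 (abs_le.1 hc).2
    linarith
  induction n generalizing t with
  | zero =>
    set s := (a ^ 2 + b ^ 2 + c ^ 2) / 3
    have e : weightCharFun a b c 0 t = Complex.exp (Complex.I * (t * c : ℝ)) := by
      simp [weightCharFun, stirlingPerms, totalWeight, gapWeight, _root_.ext, mul_comm]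
    have h1 : ‖weightCharFun a b c 0 t - 1‖ ≤ M * |t| := by
      rw [e]
      refine Real.norm_exp_I_mul_ofReal_sub_one_le.trans ?_
      rw [Real.norm_eq_abs, abs_mul, mul_comm]
      gcongr
    have h2 : |1 - Real.exp (-(s * t ^ 2 / 8))| ≤ (M * |t|) ^ 2 := by
      have := abs_exp_neg_sub_exp_neg_le le_rfl (show 0 ≤ s * t ^ 2 / 8 by positivity)
      rw [neg_zero, Real.exp_zero, zero_sub, abs_neg,
        abs_of_nonneg (show 0 ≤ s * t ^ 2 / 8 by positivity)] at this
      refine this.trans ?_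
      rw [mul_pow, sq_abs]
      nlinarith [mul_le_mul_of_nonneg_right hsM (sq_nonneg t), mul_nonneg hs0 (sq_nonneg t)]
    have h3 : ‖weightCharFun a b c 0 t - Real.exp (-(s * t ^ 2 / 8))‖ ≤
        M * |t| + (M * |t|) ^ 2 := by
      rw [← sub_add_sub_cancel _ (1 : ℂ)]
      refine (norm_add_le _ _).trans (add_le_add h1 ?_)
      rw [← Complex.ofReal_one, ← Complex.ofReal_sub, Complex.norm_real]
      exact h2
    simp only [Nat.cast_zero, mul_zero, zero_add, mul_one, Real.sqrt_one, one_mul]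
    refine h3.trans ?_
    have : 0 ≤ M * |t| := by positivity
    nlinarith [pow_nonneg this 2, pow_nonneg this 3]
  | succ n ih =>
    have hstep := norm_weightCharFun_succ_sub_le h0 ha hb hc n ht
    set s := (a ^ 2 + b ^ 2 + c ^ 2) / 3
    set N : ℝ := 2 * n + 1 with hN
    have hN1 : 1 ≤ N := by simp [hN]
    have hN0 : 0 < N := by linarith
    set r : ℝ := 2 * n / N with hr
    have hrN : r * N = N - 1 := by
      rw [hr, div_mul_cancel₀ _ hN0.ne', hN]
      ring
    have hr0 : 0 ≤ r := by positivity
    have hr1 : r ≤ 1 := by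
      by_contra h
      nlinarith
    set ε := M * |t| with hε
    have hε0 : 0 ≤ ε := by positivity
    have hrt : M * |r * t| = r * ε := by
      rw [abs_mul, abs_of_nonneg hr0]
      ring
    have hih := ih (t := r * t) (by rw [hrt]; nlinarith)
    rw [hrt] at hih
    have hcast : (2 * ((n + 1 : ℕ) : ℝ) + 1) = N + 2 := by
      rw [hN]
      push_cast
      ring
    rw [hcast]
    have hsq : √N * √N = N := Real.mul_self_sqrt hN0.le
    have hsq1 : 1 ≤ √N := Real.one_le_sqrt.2 hN1
    have hsq2 : √N ≤ √(N + 2) := Real.sqrt_le_sqrt (by linarith)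
    have hexp : |Real.exp (-(s * N * (r * t) ^ 2 / 8)) * Real.exp (-(s * t ^ 2 / 2)) -
        Real.exp (-(s * (N + 2) * t ^ 2 / 8))| ≤ ε ^ 2 / √N := by
      rw [← Real.exp_add, ← neg_add]
      refine (abs_exp_neg_sub_exp_neg_le (by positivity) (by positivity)).trans ?_
      have e : s * N * (r * t) ^ 2 / 8 + s * t ^ 2 / 2 - s * (N + 2) * t ^ 2 / 8 =
          s * t ^ 2 / (8 * N) := by
        have : r = (N - 1) / N := by
          rw [← hrN]
          field_simp
        rw [this]
        field_simp
        ring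
      rw [e, abs_of_nonneg (by positivity), hε, mul_pow, sq_abs]
      gcongr
      nlinarith
    have hle1 : ‖(Real.exp (-(s * t ^ 2 / 2)) : ℂ)‖ ≤ 1 := by
      rw [Complex.norm_real, Real.norm_of_nonneg (Real.exp_pos _).le]
      exact Real.exp_le_one_iff.2 (neg_nonpos.2 (by positivity))
    have key : weightCharFun a b c (n + 1) t - Real.exp (-(s * (N + 2) * t ^ 2 / 8)) =
        (weightCharFun a b c (n + 1) t -
          weightCharFun a b c n (r * t) * Real.exp (-(s * t ^ 2 / 2))) +
        (weightCharFun a b c n (r * t) - Real.exp (-(s * N * (r * t) ^ 2 / 8))) *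
          Real.exp (-(s * t ^ 2 / 2)) +
        ((Real.exp (-(s * N * (r * t) ^ 2 / 8)) * Real.exp (-(s * t ^ 2 / 2)) -
          Real.exp (-(s * (N + 2) * t ^ 2 / 8)) : ℝ) : ℂ) := by
      push_cast
      ring
    rw [key]
    refine (norm_add₃_le).trans ?_
    rw [norm_mul]
    rw [← Real.norm_eq_abs, ← Complex.norm_real] at hexp
    have hmul := (mul_le_of_le_one_right (norm_nonneg
      (weightCharFun a b c n (r * t) - Real.exp (-(s * N * (r * t) ^ 2 / 8)))) hle1).trans hih
    refine (add_le_add (add_le_add hstep hmul) hexp).trans ?_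
    have c1 : r * ε ≤ ε := mul_le_of_le_one_left hε0 hr1
    have c2 : √N * (r * ε) ^ 2 + ε ^ 2 / √N ≤ √(N + 2) * ε ^ 2 := by
      have h1 : N * (1 - r ^ 2) = 1 + r := by linear_combination (-r - 1) * hrN
      have h2 : ε ^ 2 / √N ≤ √N * ε ^ 2 * (1 - r ^ 2) := by
        rw [div_le_iff₀ (by positivity)]
        have h3 : √N * ε ^ 2 * (1 - r ^ 2) * √N = (1 + r) * ε ^ 2 := by
          linear_combination ε ^ 2 * (1 - r ^ 2) * hsq + ε ^ 2 * h1
        rw [h3]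
        exact le_mul_of_one_le_left (sq_nonneg ε) (by linarith)
      calc √N * (r * ε) ^ 2 + ε ^ 2 / √N
          ≤ √N * (r * ε) ^ 2 + √N * ε ^ 2 * (1 - r ^ 2) := by gcongr
        _ = √N * ε ^ 2 := by ring
        _ ≤ √(N + 2) * ε ^ 2 := by gcongr
    have c3 : N * (r * ε) ^ 3 + ε ^ 3 ≤ (N + 2) * ε ^ 3 := by
      have : N * r ^ 3 ≤ N := mul_le_of_le_one_right hN0.le (pow_le_one₀ hr0 hr1)
      nlinarith [mul_le_mul_of_nonneg_right this (pow_nonneg hε0 3), pow_nonneg hε0 3]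
    have c4 : 0 ≤ ε ^ 3 := by positivity
    linarith

theorem tendsto_weightCharFun_div_sqrt {a b c : ℝ} (h0 : a + b + c = 0) (t : ℝ) :
    Filter.Tendsto (fun n : ℕ => weightCharFun a b c n (t / √n)) Filter.atTop
      (nhds (Real.exp (-((a ^ 2 + b ^ 2 + c ^ 2) / 3 * t ^ 2 / 4)) : ℂ)) := by
  set M := |a| + |b| + |c| with hM
  set s := (a ^ 2 + b ^ 2 + c ^ 2) / 3
  have ha : |a| ≤ M := by linarith [abs_nonneg b, abs_nonneg c]
  have hb : |b| ≤ M := by linarith [abs_nonneg a, abs_nonneg c]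
  have hc : |c| ≤ M := by linarith [abs_nonneg a, abs_nonneg b]
  have hM0 : 0 ≤ M := (abs_nonneg a).trans ha
  set K := M * |t| with hK
  have hK0 : 0 ≤ K := by positivity
  have hsqrt : Filter.Tendsto (fun n : ℕ => √(n : ℝ)) Filter.atTop Filter.atTop :=
    Real.tendsto_sqrt_atTop.comp tendsto_natCast_atTop_atTop
  have hdiff : Filter.Tendsto (fun n : ℕ => weightCharFun a b c n (t / √n) -
      (Real.exp (-(s * (2 * n + 1) * (t / √n) ^ 2 / 8)) : ℂ)) Filter.atTop (nhds 0) := by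
    refine squeeze_zero_norm' ?_ (hsqrt.const_div_atTop (3 * (K + 2 * K ^ 2 + 3 * K ^ 3)))
    filter_upwards [hsqrt.eventually_ge_atTop K, Filter.eventually_ge_atTop 1] with n hn hn1
    have hn1' : (1 : ℝ) ≤ n := by exact_mod_cast hn1
    set q := √(n : ℝ) with hq
    have hq1 : 1 ≤ q := Real.one_le_sqrt.2 hn1'
    have hq0 : 0 < q := by linarith
    have hqn : q ^ 2 = n := Real.sq_sqrt (by linarith)
    have hε : M * |t / q| = K / q := by rw [abs_div, abs_of_pos hq0, hK, mul_div_assoc]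
    have h := norm_weightCharFun_sub_exp_le h0 ha hb hc n (t := t / q)
      (by rw [hε]; exact (div_le_one hq0).2 hn)
    rw [hε] at h
    refine h.trans ?_
    have h2 : √(2 * n + 1) ≤ 2 * q := by
      rw [Real.sqrt_le_left (by positivity), mul_pow, hqn]
      linarith
    calc 3 * (K / q + √(2 * n + 1) * (K / q) ^ 2 + (2 * n + 1) * (K / q) ^ 3)
        ≤ 3 * (K / q + 2 * q * (K / q) ^ 2 + 3 * q ^ 2 * (K / q) ^ 3) := by
          gcongr
          rw [hqn]
          linarith
      _ = 3 * (K + 2 * K ^ 2 + 3 * K ^ 3) / q := by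
          field_simp
  have hexp : Filter.Tendsto (fun n : ℕ => Real.exp (-(s * (2 * n + 1) * (t / √n) ^ 2 / 8)))
      Filter.atTop (nhds (Real.exp (-(s * t ^ 2 / 4)))) := by
    refine (Real.continuous_exp.tendsto _).comp ?_
    have h1 : Filter.Tendsto (fun n : ℕ => -(s * t ^ 2 / 4 + s * t ^ 2 / 8 / (n : ℝ)))
        Filter.atTop (nhds (-(s * t ^ 2 / 4 + 0))) :=
      ((tendsto_natCast_atTop_atTop.const_div_atTop _).const_add _).neg
    rw [add_zero] at h1
    refine h1.congr' ?_
    filter_upwards [Filter.eventually_ge_atTop 1] with n hn1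
    have hn1' : (0 : ℝ) < n := by exact_mod_cast hn1
    rw [div_pow, Real.sq_sqrt hn1'.le]
    field_simp
    ring
  have := hdiff.add ((Complex.continuous_ofReal.tendsto _).comp hexp)
  simpa using this

theorem totalWeight_sub_const (a b c m : ℝ) {n : ℕ} {l : List ℕ} (hl : l ∈ stirlingPerms n) :
    totalWeight a b c l = totalWeight (a - m) (b - m) (c - m) l + (2 * n + 1) * m := by
  have e : ∀ x y, gapWeight a b c x y = gapWeight (a - m) (b - m) (c - m) x y + m := by
    intro x y
    unfold gapWeight
    split_ifs <;> ring
  simp only [totalWeight, e, sum_add_distrib, (mem_stirlingPerms.1 hl).1]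
  simp

theorem setOf_isStirlingPerm (n : ℕ) : {l : List ℕ | IsStirlingPerm n l} = stirlingPerms n := by
  ext l
  simp [mem_stirlingPerms]

instance : DiscreteMeasurableSpace (List ℕ) := ⟨fun _ => trivial⟩

instance (n : ℕ) : IsProbabilityMeasure (uniformStirling n) := by
  constructor
  have := (stirlingPerms_nonempty n).card_ne_zero
  rw [uniformStirling, setOf_isStirlingPerm, Set.ncard_coe_finset, Measure.smul_apply,
    Measure.restrict_apply_univ, Measure.count_apply_finset, smul_eq_mul]
  exact ENNReal.inv_mul_cancel (by simpa using this) (by simp)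

theorem integral_uniformStirling (n : ℕ) (F : List ℕ → ℂ) :
    ∫ l, F l ∂uniformStirling n = 𝔼 l ∈ stirlingPerms n, F l := by
  have hint : IntegrableOn F (stirlingPerms n) Measure.count := by
    rw [← Set.biUnion_of_singleton (stirlingPerms n : Set (List ℕ)),
      integrableOn_finite_biUnion (Finset.finite_toSet _)]
    exact fun l _ => integrableOn_singleton (by simp) (by simp)
  rw [uniformStirling, setOf_isStirlingPerm, Set.ncard_coe_finset, integral_smul_measure,
    setIntegral_finset _ hint, expect_eq_sum_div_card]
  simp [div_eq_inv_mul, Measure.real]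

/-- Joint asymptotic normality of `(X_n, Y_n, Z_n)` (numbers of ascents, descents and
plateaux of a uniformly random Stirling permutation of length `2n`), with asymptotic
covariance matrix `Σ = (1/18)·[[2,-1,-1],[-1,2,-1],[-1,-1,2]]`: for all reals
`α, β, γ`, the linear combination
`n^{-1/2}(α(X_n - 2n/3) + β(Y_n - 2n/3) + γ(Z_n - 2n/3))` converges in distribution to
`N(0, σ²)` with `σ² = (2α² + 2β² + 2γ² - 2αβ - 2αγ - 2βγ)/18`. Convergence in
distribution is expressed by convergence of the integrals of every bounded continuous
function `f : ℝ → ℝ`. -/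
theorem joint_clt_ascents_descents_plateaux (α β γ : ℝ)
    (f : BoundedContinuousFunction ℝ ℝ) :
    Filter.Tendsto
      (fun n : ℕ => ∫ l,
          f ((α * ((ascents l : ℝ) - 2 * n / 3) + β * ((descents l : ℝ) - 2 * n / 3)
              + γ * ((plateaux l : ℝ) - 2 * n / 3)) / Real.sqrt n)
        ∂(uniformStirling n))
      Filter.atTop
      (nhds (∫ x, f x
        ∂(gaussianReal 0
          (Real.toNNReal ((2 * α ^ 2 + 2 * β ^ 2 + 2 * γ ^ 2
            - 2 * α * β - 2 * α * γ - 2 * β * γ) / 18))))) := by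
  have hstat : ∀ n : ℕ, Measurable fun l : List ℕ =>
      (α * ((ascents l : ℝ) - 2 * n / 3) + β * ((descents l : ℝ) - 2 * n / 3)
        + γ * ((plateaux l : ℝ) - 2 * n / 3)) / √n := fun n => measurable_from_top
  let μ : ℕ → ProbabilityMeasure ℝ := fun n => ⟨(uniformStirling n).map fun l : List ℕ =>
    (α * ((ascents l : ℝ) - 2 * n / 3) + β * ((descents l : ℝ) - 2 * n / 3)
      + γ * ((plateaux l : ℝ) - 2 * n / 3)) / √n,
    Measure.isProbabilityMeasure_map (hstat n).aemeasurable⟩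
  let ν : ProbabilityMeasure ℝ := ⟨gaussianReal 0 (Real.toNNReal ((2 * α ^ 2 + 2 * β ^ 2
    + 2 * γ ^ 2 - 2 * α * β - 2 * α * γ - 2 * β * γ) / 18)), inferInstance⟩
  have hμ : Filter.Tendsto μ Filter.atTop (nhds ν) := by
    refine ProbabilityMeasure.tendsto_iff_tendsto_charFun.2 fun t => ?_
    set m := (α + β + γ) / 3 with hm
    have h0 : (α - m) + (β - m) + (γ - m) = 0 := by
      rw [hm]
      ring
    have hν : charFun (ν : Measure ℝ) t =
        Real.exp (-(((α - m) ^ 2 + (β - m) ^ 2 + (γ - m) ^ 2) / 3 * t ^ 2 / 4)) := by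
      have hvar : (2 * α ^ 2 + 2 * β ^ 2 + 2 * γ ^ 2 - 2 * α * β - 2 * α * γ - 2 * β * γ) / 18 =
          ((α - m) ^ 2 + (β - m) ^ 2 + (γ - m) ^ 2) / 6 := by
        rw [hm]
        ring
      simp only [ν, ProbabilityMeasure.coe_mk]
      rw [charFun_gaussianReal, hvar, Real.coe_toNNReal _ (by positivity)]
      push_cast
      congr 1
      ring
    have hchar : ∀ n, charFun (μ n : Measure ℝ) t =
        Complex.exp ((t * m / √n : ℝ) * Complex.I) *
          weightCharFun (α - m) (β - m) (γ - m) n (t / √n) := by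
      intro n
      simp only [μ, ProbabilityMeasure.coe_mk]
      rw [charFun_apply_real, integral_map (hstat n).aemeasurable (by fun_prop),
        integral_uniformStirling, weightCharFun, mul_expect]
      refine expect_congr rfl fun l hl => ?_
      rw [← Complex.exp_add, ← add_mul, ← Complex.ofReal_add, ← Complex.ofReal_mul]
      congr 3
      have h1 := totalWeight_sub_const α β γ m hl
      rw [totalWeight_eq α] at h1
      have h2 : α * ((ascents l : ℝ) - 2 * n / 3) + β * ((descents l : ℝ) - 2 * n / 3)
          + γ * ((plateaux l : ℝ) - 2 * n / 3) =
            totalWeight (α - m) (β - m) (γ - m) l + m := by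
        linear_combination h1 + 2 * n * hm
      rw [h2]
      ring
    rw [hν, ← one_mul (Complex.ofReal _)]
    simp_rw [hchar]
    refine Filter.Tendsto.mul ?_ (tendsto_weightCharFun_div_sqrt h0 t)
    have hlim : Filter.Tendsto (fun n : ℕ => t * m / √(n : ℝ)) Filter.atTop (nhds 0) :=
      (Real.tendsto_sqrt_atTop.comp tendsto_natCast_atTop_atTop).const_div_atTop _
    have hcont : Continuous fun x : ℝ => Complex.exp (x * Complex.I) := by fun_prop
    have h := (hcont.tendsto 0).comp hlim
    simp only [Complex.ofReal_zero, zero_mul, Complex.exp_zero] at h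
    exact h
  refine (ProbabilityMeasure.tendsto_iff_forall_integral_tendsto.1 hμ f).congr fun n => ?_
  exact integral_map (hstat n).aemeasurable f.continuous.aestronglyMeasurable
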